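/- Let μ > 0 and v⁻ > 0. Let w, v : ℝ → ℝ be measurable with |w(Z)| ≤ 3π/2 and v(Z) ≥ v⁻ for almost every Z, and ∫_ℝ w(Z)² dZ ≤ μ². Then for all Z₁ < Z₂, ∫_{Z₁}^{Z₂} v(s) cos²(w(s)/2) ds ≥ (v⁻/2)·((Z₂ − Z₁) − μ²). -/

import Mathlib

open MeasureTheory Real

/-- The elementary bound `(1 - x²)/2 ≤ cos²(x/2)`. -/
theorem one_sub_sq_div_two_le_cos_half_sq (x : ℝ) :
    (1 - x ^ 2) / 2 ≤ Real.cos (x / 2) ^ 2 := by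
  have h := Real.one_sub_sq_div_two_le_cos (x := x)
  rw [Real.cos_sq, show 2 * (x / 2) = x by ring]
  linarith [sq_nonneg x]

/-- If `w, v : ℝ → ℝ` are measurable, `|w| ≤ 3π/2` and `v ≥ v⁻ > 0` a.e., and
the Lebesgue integral `∫ w² ≤ μ²`, then for all `Z₁ < Z₂` the Lebesgue integral
`∫_{Z₁}^{Z₂} v cos²(w/2) ≥ (v⁻/2)((Z₂ - Z₁) - μ²)`. -/
theorem stmt_8 (μ vneg : ℝ) (hμ : 0 < μ) (hvneg : 0 < vneg)
    (w v : ℝ → ℝ) (hw : Measurable w) (hv : Measurable v)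
    (hwb : ∀ᵐ Z : ℝ ∂volume, |w Z| ≤ 3 * π / 2)
    (hvb : ∀ᵐ Z : ℝ ∂volume, vneg ≤ v Z)
    (hL2 : ∫⁻ Z : ℝ, ENNReal.ofReal (w Z ^ 2) ≤ ENNReal.ofReal (μ ^ 2)) :
    ∀ Z₁ Z₂ : ℝ, Z₁ < Z₂ →
      ENNReal.ofReal (vneg / 2 * ((Z₂ - Z₁) - μ ^ 2)) ≤
        ∫⁻ s in Set.Ioc Z₁ Z₂, ENNReal.ofReal (v s * Real.cos (w s / 2) ^ 2) := by
  intro Z₁ Z₂ hZ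
  have hc : 0 ≤ vneg / 2 := by positivity
  have hpt : ∀ᵐ s ∂(volume.restrict (Set.Ioc Z₁ Z₂)), ENNReal.ofReal (vneg / 2) ≤
      ENNReal.ofReal (v s * Real.cos (w s / 2) ^ 2) +
        ENNReal.ofReal (vneg / 2) * ENNReal.ofReal (w s ^ 2) := by
    filter_upwards [ae_restrict_of_ae hvb] with s hs
    have hcos := one_sub_sq_div_two_le_cos_half_sq (w s)
    rw [← ENNReal.ofReal_mul hc,
      ← ENNReal.ofReal_add (mul_nonneg (hvneg.le.trans hs) (sq_nonneg _)) (by positivity)]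
    refine ENNReal.ofReal_le_ofReal ?_
    have h₁ := mul_le_mul_of_nonneg_right hs (sq_nonneg (Real.cos (w s / 2)))
    have h₂ := mul_le_mul_of_nonneg_left hcos hvneg.le
    linarith
  have hint := lintegral_mono_ae hpt
  rw [lintegral_add_left (by fun_prop), lintegral_const_mul _ (by fun_prop), lintegral_const,
    Measure.restrict_apply_univ, Real.volume_Ioc, ← ENNReal.ofReal_mul hc] at hint
  rw [mul_sub, ENNReal.ofReal_sub _ (by positivity), tsub_le_iff_right,
    ENNReal.ofReal_mul hc (q := μ ^ 2)]
  refine hint.trans ?_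
  gcongr
  exact (setLIntegral_le_lintegral _ _).trans hL2
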